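/- arXiv:0904.3561 — 2 statements merged into one kernel-verified Lean document; each statement's English description precedes it below -/
import Mathlib

section
/- Let k be a perfect field and A = k[x₁,…,xₙ]/I a reduced equidimensional ring with I = ⟨f₁,…,fₜ⟩ of dimension r. Let M be the image in A of the ideal generated by the (n−r)×(n−r)-minors of the Jacobian matrix (∂fᵢ/∂xⱼ). Then M is not contained in any minimal prime of A; hence M contains a non-zerodivisor on A. -/
set_option synthInstance.maxHeartbeats 1000000
set_option maxHeartbeats 1000000
universe u
open MvPolynomial

theorem dim_le_aux {R S : Type*} [CommRing R] [CommRing S] [Algebra R S] [Algebra.IsIntegral R S]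
    [FaithfulSMul R S] : ringKrullDim R ≤ ringKrullDim S := by
  refine iSup_le fun l => ?_
  obtain ⟨Q, hQ, hQ'⟩ : ∃ Q : Ideal S, Q.IsPrime ∧ Q.comap (algebraMap R S) = l.head.asIdeal := by
    obtain ⟨Q, -, h1, h2⟩ := Ideal.exists_ideal_over_prime_of_isIntegral (S := S) l.head.asIdeal ⊥ (by
      rw [← RingHom.ker_eq_comap_bot, (RingHom.injective_iff_ker_eq_bot _).1
        (FaithfulSMul.algebraMap_injective R S)]; exact bot_le)
    exact ⟨Q, h1, h2⟩
  have : Q.LiesOver l.head.asIdeal := ⟨hQ'.symm⟩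
  obtain ⟨L, h1, -⟩ := Ideal.exists_ltSeries_of_hasGoingUp l Q
  rw [← h1]
  exact Order.LTSeries.length_le_krullDim L

theorem card_le_aux {k B K : Type u} [Field k] [CommRing B] [IsDomain B] [Algebra k B]
    [Algebra.FiniteType k B] [Field K] [Algebra B K] [Algebra k K] [IsScalarTower k B K]
    [IsFractionRing B K] (r : ℕ) (hr : ringKrullDim B = r) (s : Finset K)
    (hs : IsTranscendenceBasis k ((↑) : s → K)) : s.card ≤ r := by
  obtain ⟨d, g, hg, hint⟩ := exists_integral_inj_algHom_of_fg k B
  algebraize [g.toRingHom]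
  have : IsScalarTower k (MvPolynomial (Fin d) k) B := IsScalarTower.of_algebraMap_eq' (by
    ext x; exact (g.commutes x).symm)
  have : FaithfulSMul (MvPolynomial (Fin d) k) B := (faithfulSMul_iff_algebraMap_injective _ _).2 hg
  have h1 : ringKrullDim (MvPolynomial (Fin d) k) ≤ ringKrullDim B := dim_le_aux
  rw [MvPolynomial.ringKrullDim_of_isNoetherianRing, hr, ringKrullDim_eq_zero_of_field] at h1
  simp at h1
  have h1' : d ≤ r := by exact_mod_cast h1
  refine le_trans ?_ h1'
  have h2 := hs.cardinalMk_eq_trdeg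
  have h3 := _root_.trdeg_add_eq k (MvPolynomial (Fin d) k) (A := B)
  have h4 := _root_.trdeg_add_eq k B (A := K)
  have : Algebra.IsAlgebraic B K := IsLocalization.isAlgebraic K (nonZeroDivisors B)
  rw [_root_.trdeg_eq_zero (R := MvPolynomial (Fin d) k) (A := B), add_zero] at h3
  rw [_root_.trdeg_eq_zero (R := B) (A := K), add_zero] at h4
  rw [← h4, ← h3, MvPolynomial.trdeg_of_isDomain] at h2
  simp at h2
  exact_mod_cast h2.le

theorem der_zero_aux {k K V : Type*} [Field k] [Field K] [Algebra k K] [AddCommGroup V]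
    [Module K V] [Module k V] [IsScalarTower k K V] (s : Set K)
    [Algebra.IsSeparable (IntermediateField.adjoin k s) K]
    (D : Derivation k K V) (h : ∀ x ∈ s, D x = 0) (x : K) : D x = 0 := by
  have hF : ∀ y ∈ IntermediateField.adjoin k s, D y = 0 := by
    intro y hy
    induction hy using IntermediateField.adjoin_induction with
    | mem x hx => exact h x hx
    | algebraMap x => simp
    | add x y _ _ hx hy => simp [hx, hy]
    | inv x _ hx => simp [Derivation.leibniz_inv, hx]
    | mul x y _ _ hx hy => simp [hx, hy]
  let F := IntermediateField.adjoin k s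
  let D' : Derivation F K V := Derivation.mk' (R := F)
    { toFun := D, map_add' := by simp, map_smul' := by
        intro c x
        change D ((c : K) * x) = (c : K) • D x
        simp [hF _ c.2] } (by intro a b; exact D.leibniz a b)
  have hq := D'.map_aeval (minpoly F x) x
  rw [minpoly.aeval, map_zero] at hq
  have hsep := Algebra.IsSeparable.isSeparable F x
  have := hsep.aeval_derivative_ne_zero (minpoly.aeval F x)
  exact (smul_eq_zero.1 hq.symm).resolve_left this

theorem finrank_le_aux {k K V : Type*} [Field k] [Field K] [Algebra k K] [AddCommGroup V]
    [Module K V] [Module k V] [IsScalarTower k K V] (s : Finset K)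
    [Algebra.IsSeparable (IntermediateField.adjoin k (s : Set K)) K]
    (D : Derivation k K V) (h : Submodule.span K (Set.range D) = ⊤) :
    Module.finrank K V ≤ s.card := by
  classical
  let W := Submodule.span K ((s.image D : Finset V) : Set V)
  have hW : W = ⊤ := by
    rw [eq_top_iff, ← h, Submodule.span_le]
    rintro _ ⟨x, rfl⟩
    have := der_zero_aux (s : Set K) (W.mkQ.compDer D) (fun x hx => by
      simp only [Derivation.coe_comp]
      exact (Submodule.Quotient.mk_eq_zero W).2 (Submodule.subset_span (by simpa using ⟨x, hx, rfl⟩))) x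
    exact (Submodule.Quotient.mk_eq_zero W).1 this
  calc Module.finrank K V = Module.finrank K (⊤ : Submodule K V) := (finrank_top K V).symm
    _ = Module.finrank K W := by rw [hW]
    _ ≤ (s.image D).card := finrank_span_finset_le_card _
    _ ≤ s.card := Finset.card_image_le

open KaehlerDifferential in
theorem extend_aux {k B K V : Type*} [Field k] [CommRing B] [IsDomain B] [Algebra k B]
    [Field K] [Algebra B K] [Algebra k K] [IsScalarTower k B K]
    [IsFractionRing B K] [AddCommGroup V] [Module K V] [Module k V] [Module B V]
    [IsScalarTower k K V] [IsScalarTower B K V] [IsScalarTower k B V]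
    (D₀ : Derivation k B V) : ∃ D : Derivation k K V, ∀ b, D (algebraMap B K b) = D₀ b := by
  have := Algebra.FormallyEtale.of_isLocalization (Rₘ := K) (nonZeroDivisors B)
  have hb := KaehlerDifferential.isBaseChange_of_formallyEtale k B K
  refine ⟨(hb.lift D₀.liftKaehlerDifferential).compDer (KaehlerDifferential.D k K), fun b => ?_⟩
  have := hb.lift_eq D₀.liftKaehlerDifferential (KaehlerDifferential.D k B b)
  simpa using this

theorem minor_aux {K : Type*} [Field K] {t n m : ℕ} (A : Matrix (Fin t) (Fin n) K)
    (h : m ≤ A.rank) : ∃ (rs : Fin m → Fin t) (cs : Fin m → Fin n), Function.Injective rs ∧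
      Function.Injective cs ∧ (A.submatrix rs cs).det ≠ 0 := by
  have key : ∀ {a b : ℕ} (A : Matrix (Fin a) (Fin b) K), m ≤ A.rank →
      ∃ rs : Fin m → Fin a, LinearIndependent K (A.submatrix rs id).row := by
    intro a b A h
    rw [A.rank_eq_finrank_span_row] at h
    obtain ⟨f, h1, -, h3⟩ := Submodule.exists_fun_fin_finrank_span_eq K (Set.range A.row)
    choose g hg using h1
    refine ⟨g ∘ Fin.castLE h, ?_⟩
    have h4 := h3.comp _ (Fin.castLE_injective h)
    have h5 : (A.submatrix (g ∘ Fin.castLE h) id).row = f ∘ Fin.castLE h := by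
      ext i : 1
      exact hg _
    rw [h5]
    exact h4
  obtain ⟨rs, hrs⟩ := key A h
  obtain ⟨cs, hcs⟩ := key (A.submatrix rs id).transpose (by
    rw [Matrix.rank_transpose, hrs.rank_matrix]; simp)
  have hinj : ∀ {a b c : ℕ} (A : Matrix (Fin a) (Fin b) K) (rs : Fin c → Fin a),
      LinearIndependent K (A.submatrix rs id).row → Function.Injective rs := by
    intro a b c A rs h i j hij
    apply h.injective
    ext l
    simp [Matrix.row, hij]
  refine ⟨rs, cs, hinj _ _ hrs, hinj _ _ hcs, ?_⟩
  rw [Matrix.linearIndependent_rows_iff_isUnit, Matrix.isUnit_iff_isUnit_det, isUnit_iff_ne_zero] at hcs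
  rw [← Matrix.det_transpose]
  exact hcs

theorem rank_aux {k : Type u} [Field k] [PerfectField k] {n t : ℕ} (r : ℕ)
    (f : Fin t → MvPolynomial (Fin n) k) (P : Ideal (MvPolynomial (Fin n) k)) [P.IsPrime]
    (hf : ∀ i, f i ∈ P)
    (hP : ∀ p ∈ P, ∃ s ∉ P, p * s ∈ Ideal.span (Set.range f))
    (hr : ringKrullDim (MvPolynomial (Fin n) k ⧸ P) = r)
    (K : Type u) [Field K] [Algebra (MvPolynomial (Fin n) k ⧸ P) K]
    [Algebra (MvPolynomial (Fin n) k) K] [Algebra k K]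
    [IsScalarTower (MvPolynomial (Fin n) k) (MvPolynomial (Fin n) k ⧸ P) K]
    [IsScalarTower k (MvPolynomial (Fin n) k ⧸ P) K]
    [IsScalarTower k (MvPolynomial (Fin n) k) K]
    [IsFractionRing (MvPolynomial (Fin n) k ⧸ P) K] :
    n - r ≤ (Matrix.of fun i j =>
      algebraMap (MvPolynomial (Fin n) k) K (pderiv j (f i))).rank := by
  classical
  let S := MvPolynomial (Fin n) k
  let A := Matrix.of fun i j => algebraMap S K (pderiv j (f i))
  let W : Submodule K (Fin n → K) := Submodule.span K (Set.range A.row)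
  let V := (Fin n → K) ⧸ W
  let Dpi : Derivation k S (Fin n → K) := mkDerivation k (fun j => Pi.single j 1)
  have hDpi : ∀ g j, Dpi g j = algebraMap S K (pderiv j g) := by
    intro g j
    have : (LinearMap.proj (R := S) (φ := fun _ : Fin n => K) j).compDer Dpi
        = (Algebra.linearMap S K).compDer (pderiv j) := by
      apply MvPolynomial.derivation_ext
      intro i
      by_cases hij : i = j
      · subst hij
        simp only [Dpi, Derivation.coe_comp]
        change mkDerivation k (fun j => Pi.single j (1 : K)) (X i) i = algebraMap (MvPolynomial (Fin n) k) K (pderiv i (X i))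
        rw [mkDerivation_X, pderiv_X_self, map_one, Pi.single_eq_same]
      · simp [Dpi, pderiv_X_of_ne hij, Pi.single_apply, Ne.symm hij]
    exact DFunLike.congr_fun this g
  let D1 : Derivation k S V := (W.mkQ.restrictScalars S).compDer Dpi
  have hD1f : ∀ i, D1 (f i) = 0 := by
    intro i
    refine (Submodule.Quotient.mk_eq_zero W).2 (Submodule.subset_span ⟨i, ?_⟩)
    ext j
    exact (hDpi (f i) j).symm
  have hsm : ∀ (g : S) (v : V), g • v = algebraMap S K g • v := fun g v =>
    (algebraMap_smul K g v).symm
  have hz : ∀ g ∈ P, algebraMap S K g = 0 := by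
    intro g hg
    rw [IsScalarTower.algebraMap_apply S (S ⧸ P) K, Ideal.Quotient.algebraMap_eq,
      Ideal.Quotient.eq_zero_iff_mem.2 hg, map_zero]
  have hz' : ∀ g, algebraMap S K g = 0 → g ∈ P := by
    intro g hg
    rw [IsScalarTower.algebraMap_apply S (S ⧸ P) K, Ideal.Quotient.algebraMap_eq] at hg
    exact Ideal.Quotient.eq_zero_iff_mem.1
      ((IsFractionRing.injective (S ⧸ P) K) (hg.trans (map_zero _).symm))
  have hD1I : ∀ g ∈ Ideal.span (Set.range f), D1 g = 0 := by
    intro g hg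
    induction hg using Submodule.span_induction with
    | mem x h => obtain ⟨i, rfl⟩ := h; exact hD1f i
    | zero => simp
    | add x y _ _ hx hy => simp only [map_add, hx, hy, add_zero]
    | smul a x hx' hx =>
      have hxP : x ∈ P := (Ideal.span_le.2 (by rintro _ ⟨i, rfl⟩; exact hf i)) hx'
      rw [smul_eq_mul, Derivation.leibniz, hx, smul_zero, zero_add, hsm, hz x hxP, zero_smul]
  have hD1P : ∀ g ∈ P, D1 g = 0 := by
    intro g hg
    obtain ⟨s, hs, hgs⟩ := hP g hg
    have := hD1I _ hgs
    rw [Derivation.leibniz, hsm g, hz g hg, zero_smul, zero_add, hsm] at this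
    exact (smul_eq_zero.1 this).resolve_left fun h => hs (hz' s h)
  let D2l : (S ⧸ P) →ₗ[k] V :=
    (Submodule.liftQ (P.restrictScalars k) (D1 : S →ₗ[k] V) (fun g hg => hD1P g hg))
  have hD2l : ∀ g : S, D2l (Ideal.Quotient.mk P g) = D1 g := fun g => rfl
  let D2 : Derivation k (S ⧸ P) V := Derivation.mk' D2l (by
    intro a b
    obtain ⟨a, rfl⟩ := Ideal.Quotient.mk_surjective a
    obtain ⟨b, rfl⟩ := Ideal.Quotient.mk_surjective b
    rw [← map_mul, hD2l, hD2l, hD2l, Derivation.leibniz]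
    have : ∀ (g : S) (v : V), Ideal.Quotient.mk P g • v = g • v := by
      intro g v
      rw [hsm, IsScalarTower.algebraMap_apply S (S ⧸ P) K, Ideal.Quotient.algebraMap_eq,
        algebraMap_smul]
    rw [this, this])
  obtain ⟨D, hD⟩ := extend_aux (K := K) D2
  have hspan : Submodule.span K (Set.range D) = ⊤ := by
    rw [eq_top_iff]
    rintro v -
    obtain ⟨w, rfl⟩ := W.mkQ_surjective v
    rw [pi_eq_sum_univ' w, map_sum]
    refine Submodule.sum_mem _ fun j _ => ?_
    rw [map_smul]
    refine Submodule.smul_mem _ _ (Submodule.subset_span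
      ⟨algebraMap _ K (Ideal.Quotient.mk P (X j)), ?_⟩)
    rw [hD]
    change W.mkQ (Dpi (X j)) = _
    congr 1
    ext i
    rw [hDpi]
    by_cases hij : j = i
    · subst hij
      simp
    · simp [pderiv_X_of_ne hij, hij, Ne.symm hij]
  have : Algebra.EssFiniteType k K := by
    have : Algebra.EssFiniteType (S ⧸ P) K := Algebra.EssFiniteType.of_isLocalization K (nonZeroDivisors (S ⧸ P))
    exact Algebra.EssFiniteType.comp k (S ⧸ P) K
  obtain ⟨s, hs, hsep⟩ := exists_isTranscendenceBasis_and_isSeparable_of_perfectField (k := k) (K := K)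
  have h1 := finrank_le_aux s D hspan
  have h2 := card_le_aux (B := S ⧸ P) r hr s hs
  have h3 := W.finrank_quotient_add_finrank
  rw [Module.finrank_fin_fun] at h3
  change n - r ≤ A.rank
  rw [A.rank_eq_finrank_span_row]
  change n - r ≤ Module.finrank K W
  change Module.finrank K ((Fin n → K) ⧸ W) ≤ _ at h1
  omega

theorem not_le_aux {k : Type u} [Field k] [PerfectField k] {n t : ℕ} (r : ℕ)
    (f : Fin t → MvPolynomial (Fin n) k) (P : Ideal (MvPolynomial (Fin n) k)) 
    (hrad : (Ideal.span (Set.range f)).IsRadical)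
    (hP : P ∈ (Ideal.span (Set.range f)).minimalPrimes)
    (hr : ringKrullDim (MvPolynomial (Fin n) k ⧸ P) = r) :
    ∃ (rs : Fin (n - r) → Fin t) (cs : Fin (n - r) → Fin n),
        Function.Injective rs ∧ Function.Injective cs ∧
        (Matrix.of fun i j => MvPolynomial.pderiv (cs j) (f (rs i))).det ∉ P := by
  have := hP.isPrime
  have hle := hP.le
  let K := FractionRing (MvPolynomial (Fin n) k ⧸ P)
  have hrank := rank_aux r f P (fun i => hle (Ideal.subset_span ⟨i, rfl⟩)) (by
    intro p hp
    have h1 := IsLocalization.AtPrime.radical_map_of_mem_minimalPrimes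
      (Localization.AtPrime P) P _ hP
    have h2 := Ideal.mem_map_of_mem (algebraMap _ (Localization.AtPrime P)) hp
    rw [← h1] at h2
    obtain ⟨N, h2⟩ := h2
    rw [← map_pow, IsLocalization.algebraMap_mem_map_algebraMap_iff P.primeCompl] at h2
    obtain ⟨m, hm, h2⟩ := h2
    refine ⟨m, hm, hrad ⟨N + 1, ?_⟩⟩
    have : (p * m) ^ (N + 1) = (p * m ^ N) * (m * p ^ N) := by ring
    rw [this]
    exact Ideal.mul_mem_left _ _ h2) hr K
  obtain ⟨rs, cs, h1, h2, h3⟩ := minor_aux _ hrank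
  refine ⟨rs, cs, h1, h2, fun h => h3 ?_⟩
  have h4 : algebraMap (MvPolynomial (Fin n) k) K
    (Matrix.of fun i j => MvPolynomial.pderiv (cs j) (f (rs i))).det = 0 := by
    rw [IsScalarTower.algebraMap_apply _ (MvPolynomial (Fin n) k ⧸ P) K, Ideal.Quotient.algebraMap_eq,
      Ideal.Quotient.eq_zero_iff_mem.2 h, map_zero]
  rw [RingHom.map_det] at h4
  exact h4

theorem nzd_aux {A : Type*} [CommRing A] [IsNoetherianRing A] [IsReduced A] (M : Ideal A)
    (h : ∀ P ∈ (⊥ : Ideal A).minimalPrimes, ¬ M ≤ P) : ∃ m ∈ M, m ∈ nonZeroDivisors A := by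
  have hfin := Ideal.finite_minimalPrimes_of_isNoetherianRing A ⊥
  have h1 : ¬ ((M : Set A) ⊆ ⋃ i ∈ (↑hfin.toFinset : Set (Ideal A)), (i : Ideal A)) := by
    rw [Ideal.subset_union_prime (f := fun i : Ideal A => i) ⊥ ⊥ (fun i hi _ _ => (hfin.mem_toFinset.1 hi).isPrime)]
    rintro ⟨i, hi, hle⟩
    exact h i (hfin.mem_toFinset.1 hi) hle
  obtain ⟨m, hm, hm'⟩ := Set.not_subset.1 h1
  refine ⟨m, hm, mem_nonZeroDivisors_iff_right.2 fun y hy => ?_⟩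
  have : y ∈ (⊥ : Ideal A).radical := by
    rw [← Ideal.sInf_minimalPrimes, Submodule.mem_sInf]
    intro P hP
    have hPp := hP.isPrime
    have : y * m ∈ P := hy ▸ P.zero_mem
    refine (hPp.mem_or_mem this).resolve_right fun hmP => hm' ?_
    simp only [Set.mem_iUnion]
    exact ⟨P, by simpa using hP, hmP⟩
  change y ∈ nilradical A at this
  rw [nilradical_eq_zero] at this
  simpa using this

/-- Over a perfect field `k`, for `A = k[x₁,…,xₙ]/I` reduced and
equidimensional of dimension `r` with `I = ⟨f₁,…,fₜ⟩`, the image `M` in `A` of the ideal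
of `(n−r)×(n−r)`-minors of the Jacobian matrix of the `fᵢ` is not contained in any
minimal prime of `A`; hence `M` contains a non-zerodivisor on `A`. -/
theorem jacobian_ideal_contains_nonzerodivisor
    (k : Type*) [Field k] [PerfectField k] (n t r : ℕ)
    (f : Fin t → MvPolynomial (Fin n) k)
    (I : Ideal (MvPolynomial (Fin n) k))
    (hI : I = Ideal.span (Set.range f))
    (hrad : I.IsRadical)
    (hdim : ringKrullDim (MvPolynomial (Fin n) k ⧸ I) = (r : WithBot ℕ∞))
    (hequi : ∀ P ∈ I.minimalPrimes,
      ringKrullDim (MvPolynomial (Fin n) k ⧸ P) = (r : WithBot ℕ∞)) :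
    let M' : Ideal (MvPolynomial (Fin n) k) :=
      Ideal.span {d | ∃ (rs : Fin (n - r) → Fin t) (cs : Fin (n - r) → Fin n),
        Function.Injective rs ∧ Function.Injective cs ∧
        d = (Matrix.of fun i j => MvPolynomial.pderiv (cs j) (f (rs i))).det}
    let M : Ideal (MvPolynomial (Fin n) k ⧸ I) := M'.map (Ideal.Quotient.mk I)
    (∀ P ∈ (⊥ : Ideal (MvPolynomial (Fin n) k ⧸ I)).minimalPrimes, ¬ M ≤ P) ∧
    ∃ m ∈ M, m ∈ nonZeroDivisors (MvPolynomial (Fin n) k ⧸ I) := by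
  intro M' M
  subst hI
  have key : ∀ P ∈ (⊥ : Ideal (MvPolynomial (Fin n) k ⧸ Ideal.span (Set.range f))).minimalPrimes,
      ¬ M ≤ P := by
    intro P hP hle
    have h1 := Ideal.minimalPrimes_comap_of_surjective
      (Ideal.Quotient.mk_surjective (I := Ideal.span (Set.range f))) hP
    rw [← RingHom.ker_eq_comap_bot, Ideal.mk_ker] at h1
    obtain ⟨rs, cs, h2, h3, h4⟩ := not_le_aux r f _ hrad h1 (hequi _ h1)
    exact h4 (hle (Ideal.mem_map_of_mem _ (Ideal.subset_span ⟨rs, cs, h2, h3, rfl⟩)))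
  have : IsReduced (MvPolynomial (Fin n) k ⧸ Ideal.span (Set.range f)) :=
    (Ideal.isRadical_iff_quotient_reduced _).1 hrad
  exact ⟨key, nzd_aux M key⟩
end

section
/- Let R = k[x₁,…,xₙ] with k a field, I ⊆ R a radical ideal, and R_> the localization of R at the multiplicative set S_> = {u ∈ R \ {0} : LM(u) = 1} for a monomial ordering >. Let I' = I·R_> ∩ R... conversely given I ⊆ R_>, set I' = I ∩ R. Then the integral closure of R_>/I in its total ring of fractions is isomorphic, as an R_>-algebra, to the localization at (the image of) S_> of the integral closure of R/I' in its total ring of fractions. In particular, the integral closure of R_>/I is a finitely generated module over R_>/I. -/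
namespace NormLoc

lemma mv_frob {σ R : Type*} [CommRing R] (p : ℕ) [ExpChar R p] (m : ℕ) (w : MvPolynomial σ R) :
    MvPolynomial.map (iterateFrobenius R p m) (MvPolynomial.expand (p ^ m) w) = w ^ p ^ m := by
  induction w using MvPolynomial.induction_on with
  | C a => simp [iterateFrobenius_def]
  | add f g hf hg => rw [map_add, map_add, hf, hg, add_pow_expChar_pow]
  | mul_X f i hf => rw [map_mul, map_mul, hf, mul_pow]; simp

lemma mv_root {σ k k' : Type*} [Field k] [Field k'] [Algebra k k'] (p : ℕ) [ExpChar k' p] (m : ℕ)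
    (u : MvPolynomial σ k)
    (h : ∀ d ∈ u.support, ∃ b : k', b ^ p ^ m = algebraMap k k' (u.coeff d)) :
    ∃ w : MvPolynomial σ k',
      w ^ p ^ m = MvPolynomial.map (algebraMap k k') (MvPolynomial.expand (p ^ m) u) := by
  classical
  choose! b hb using h
  refine ⟨∑ d ∈ u.support, MvPolynomial.monomial d (b d), ?_⟩
  rw [← mv_frob p m, MvPolynomial.map_expand, MvPolynomial.map_expand]
  congr 1
  conv_rhs => rw [u.as_sum]
  simp only [map_sum, MvPolynomial.map_monomial, iterateFrobenius_def]
  exact Finset.sum_congr rfl fun d hd => by rw [hb d hd]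

lemma exists_roots {k : Type*} [Field k] (q : ℕ) (hq : 0 < q) (T : Set k) (hT : T.Finite) :
    ∃ k' : IntermediateField k (AlgebraicClosure k), FiniteDimensional k k' ∧
      ∀ a ∈ T, ∃ b : k', b ^ q = algebraMap k k' a := by
  have h (a : k) : ∃ b : AlgebraicClosure k, b ^ q = algebraMap k _ a :=
    IsAlgClosed.exists_pow_nat_eq _ hq
  choose b hb using h
  refine ⟨IntermediateField.adjoin k (b '' T), ?_, ?_⟩
  · have := (hT.image b).to_subtype
    exact IntermediateField.finiteDimensional_adjoin fun x _ => Algebra.IsIntegral.isIntegral x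
  · intro a ha
    refine ⟨⟨b a, IntermediateField.subset_adjoin _ _ ⟨a, ha, rfl⟩⟩, ?_⟩
    apply Subtype.ext
    simpa using hb a

lemma phi_finite {k k' : Type*} [Field k] [Field k'] [Algebra k k'] [FiniteDimensional k k']
    (s q : ℕ) (hq : 0 < q) :
    ((MvPolynomial.map (σ := Fin s) (algebraMap k k')).comp
      (MvPolynomial.expand (σ := Fin s) (R := k) q).toRingHom).Finite := by
  set φ := ((MvPolynomial.map (σ := Fin s) (algebraMap k k')).comp
      (MvPolynomial.expand (σ := Fin s) (R := k) q).toRingHom) with hφ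
  have hC (c : k) : φ (MvPolynomial.C c) = MvPolynomial.C (algebraMap k k' c) := by simp [hφ]
  have hX (i) : φ (MvPolynomial.X i) = MvPolynomial.X i ^ q := by simp [hφ]
  have hcomp : φ.comp MvPolynomial.C = algebraMap k (MvPolynomial (Fin s) k') := by
    ext1 c; rw [RingHom.comp_apply, hC]; rfl
  rw [RingHom.finite_iff_isIntegral_and_finiteType]
  constructor
  · intro f
    induction f using MvPolynomial.induction_on with
    | C a =>
      have h1 : IsIntegral k (MvPolynomial.C (σ := Fin s) a) :=
        (Algebra.IsIntegral.isIntegral (R := k) a).map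
          (IsScalarTower.toAlgHom k k' (MvPolynomial (Fin s) k'))
      have h2 : (φ.comp MvPolynomial.C).IsIntegralElem (MvPolynomial.C (σ := Fin s) a) := by
        rw [hcomp]; exact h1
      exact RingHom.IsIntegralElem.of_comp h2
    | add f g hf hg => exact hf.add _ hg
    | mul_X f i hf =>
      refine hf.mul _ ?_
      let := φ.toAlgebra
      refine IsIntegral.of_pow (R := MvPolynomial (Fin s) k) hq ?_
      rw [← hX]
      exact φ.isIntegralElem_map
  · have : Algebra.FiniteType k (MvPolynomial (Fin s) k') :=
      Algebra.FiniteType.trans (S := k') inferInstance inferInstance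
    have h2 : (φ.comp MvPolynomial.C).FiniteType := by
      rw [hcomp, RingHom.finiteType_algebraMap]; exact this
    exact RingHom.FiniteType.of_comp_finiteType h2

lemma finite_of_embed {A P F E F'' : Type*} [CommRing A] [IsNoetherianRing A] [CommRing P]
    [IsDomain P] [IsIntegrallyClosed P] [Algebra A P] [Module.Finite A P] [Field F] [Field E]
    [Field F''] [Algebra A F] [Algebra F E] [Algebra A E] [IsScalarTower A F E]
    [Algebra P F''] [IsFractionRing P F''] [Algebra F F''] [Algebra A F''] [IsScalarTower A F F'']
    [IsScalarTower A P F''] (φ : E →ₐ[F] F'') : Module.Finite A (integralClosure A E) := by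
  let ψ : integralClosure A E →ₐ[A] F'' := (φ.restrictScalars A).comp (integralClosure A E).val
  let N := LinearMap.range (IsScalarTower.toAlgHom A P F'').toLinearMap
  have hN : IsNoetherian A N := inferInstance
  have hmem (x) : ψ.toLinearMap x ∈ N := by
    have h1 : IsIntegral A (ψ x) := (Algebra.IsIntegral.isIntegral (R := A) x).map ψ
    have h2 : IsIntegral P (ψ x) := h1.tower_top
    obtain ⟨y, hy⟩ := IsIntegrallyClosed.isIntegral_iff.mp h2
    exact ⟨y, hy⟩
  have := isNoetherian_of_injective (ψ.toLinearMap.codRestrict N hmem) (by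
    intro x y hxy
    have : ψ x = ψ y := congrArg Subtype.val hxy
    exact Subtype.ext (φ.injective this))
  infer_instance

lemma finite_of_roots {A P F E : Type*} [CommRing A] [IsDomain A] [IsNoetherianRing A] [CommRing P]
    [IsDomain P] [IsIntegrallyClosed P] (f : A →+* P) (hf : f.Finite)
    (hinj : Function.Injective f) [Field F] [Field E] [Algebra A F] [IsFractionRing A F]
    [Algebra F E] [FiniteDimensional F E] [Algebra A E] [IsScalarTower A F E] (p m : ℕ)
    [ExpChar P p]
    (T : Set E) (hT : IntermediateField.adjoin F T = ⊤)
    (h : ∀ e ∈ T, ∃ a d : A, d ≠ 0 ∧ e ^ p ^ m * algebraMap A E d = algebraMap A E a ∧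
      (∃ b, b ^ p ^ m = f a) ∧ ∃ c, c ^ p ^ m = f d) :
    Module.Finite A (integralClosure A E) := by
  let := f.toAlgebra
  have : Module.Finite A P := hf
  let F'' := FractionRing P
  have : ExpChar F'' p := expChar_of_injective_algebraMap (IsFractionRing.injective P F'') p
  have hinj' : Function.Injective (algebraMap A F'') := by
    rw [IsScalarTower.algebraMap_eq A P F'']
    exact (IsFractionRing.injective P F'').comp hinj
  let : Algebra F F'' := (IsFractionRing.lift hinj').toAlgebra
  have : IsScalarTower A F F'' := IsScalarTower.of_algebraMap_eq fun x =>
    (IsFractionRing.lift_algebraMap hinj' x).symm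
  have key : Nonempty (E →ₐ[F] F'') := by
    refine IntermediateField.nonempty_algHom_of_adjoin_splits (S := T) (fun e he => ?_) hT
    refine ⟨Algebra.IsIntegral.isIntegral e, ?_⟩
    obtain ⟨a, d, hd, hed, ⟨b, hb⟩, ⟨c, hc⟩⟩ := h e he
    have hdF : algebraMap A F d ≠ 0 := fun h0 => hd (IsFractionRing.injective A F (by simpa using h0))
    have hdE : algebraMap A E d ≠ 0 := by
      rw [IsScalarTower.algebraMap_apply A F E]; simpa using hdF
    have hdF'' : algebraMap A F'' d ≠ 0 := fun h0 => hd (hinj' (by simpa using h0))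
    set z : F := algebraMap A F a / algebraMap A F d with hz
    have hez : e ^ p ^ m = algebraMap F E z := by
      rw [hz, map_div₀, ← IsScalarTower.algebraMap_apply, ← IsScalarTower.algebraMap_apply,
        eq_div_iff hdE, hed]
    set y : F'' := algebraMap P F'' b / algebraMap P F'' c with hy
    have hyz : y ^ p ^ m = algebraMap F F'' z := by
      rw [hz, hy, map_div₀, ← IsScalarTower.algebraMap_apply, ← IsScalarTower.algebraMap_apply,
        div_pow, ← map_pow, ← map_pow, hb, hc, IsScalarTower.algebraMap_apply A P F'',
        IsScalarTower.algebraMap_apply A P F'']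
      rfl
    have hq : 0 < p ^ m := pow_pos (expChar_pos P p) m
    have hdvd : minpoly F e ∣ Polynomial.X ^ p ^ m - Polynomial.C z :=
      minpoly.dvd _ _ (by simp [hez])
    have hmap : (Polynomial.X ^ p ^ m - Polynomial.C z).map (algebraMap F F'') =
        (Polynomial.X - Polynomial.C y) ^ p ^ m := by
      rw [sub_pow_expChar_pow]
      simp [← hyz]
    have hne : (Polynomial.X ^ p ^ m - Polynomial.C z).map (algebraMap F F'') ≠ 0 := by
      rw [hmap]; exact pow_ne_zero _ (Polynomial.X_sub_C_ne_zero _)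
    refine Polynomial.Splits.of_dvd ?_ hne (Polynomial.map_dvd _ hdvd)
    rw [hmap]
    exact (Polynomial.Splits.X_sub_C _).pow _
  obtain ⟨φ⟩ := key
  exact finite_of_embed (P := P) (F'' := F'') φ

lemma finite_purely_insep {k : Type*} [Field k] (s : ℕ) {F E : Type*} [Field F] [Field E]
    [Algebra (MvPolynomial (Fin s) k) F] [IsFractionRing (MvPolynomial (Fin s) k) F]
    [Algebra F E] [FiniteDimensional F E] [IsPurelyInseparable F E]
    [Algebra (MvPolynomial (Fin s) k) E] [IsScalarTower (MvPolynomial (Fin s) k) F E] :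
    Module.Finite (MvPolynomial (Fin s) k) (integralClosure (MvPolynomial (Fin s) k) E) := by
  classical
  let A := MvPolynomial (Fin s) k
  let p := ringExpChar k
  have : ExpChar k p := inferInstance
  have : ExpChar A p := expChar_of_injective_algebraMap (MvPolynomial.C_injective (Fin s) k) p
  have : ExpChar F p := expChar_of_injective_algebraMap (IsFractionRing.injective A F) p
  obtain ⟨T, hT⟩ := (IntermediateField.fg_of_noetherian (⊤ : IntermediateField F E))
  let m := IsPurelyInseparable.exponent F E
  have h (e : E) : ∃ a d : A, d ≠ 0 ∧ e ^ p ^ m * algebraMap A E d = algebraMap A E a := by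
    obtain ⟨z, hz⟩ := IsPurelyInseparable.exponent_def' F p e
    obtain ⟨a, d, hd, rfl⟩ := IsFractionRing.div_surjective (A := A) z
    have hdF : algebraMap A F d ≠ 0 := fun h0 =>
      nonZeroDivisors.ne_zero hd (IsFractionRing.injective A F (by simpa using h0))
    refine ⟨a, d, nonZeroDivisors.ne_zero hd, ?_⟩
    rw [← hz, IsScalarTower.algebraMap_apply A F E, IsScalarTower.algebraMap_apply A F E,
      ← map_mul, div_mul_cancel₀ _ hdF]
  choose a d hd had using h
  have hq : 0 < p ^ m := pow_pos (expChar_pos k p) m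
  obtain ⟨k', hfin, hk'⟩ := exists_roots (k := k) (p ^ m) hq
    ((⋃ e ∈ T, ((a e).coeff '' (a e).support)) ∪ (⋃ e ∈ T, ((d e).coeff '' (d e).support)))
    (Set.Finite.union
      (Set.Finite.biUnion T.finite_toSet fun e _ => (Finset.finite_toSet _).image _)
      (Set.Finite.biUnion T.finite_toSet fun e _ => (Finset.finite_toSet _).image _))
  have : ExpChar k' p := expChar_of_injective_algebraMap (algebraMap k k').injective p
  have : ExpChar (MvPolynomial (Fin s) k') p :=
    expChar_of_injective_algebraMap (MvPolynomial.C_injective (Fin s) k') p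
  refine finite_of_roots (A := A) (F := F) _ (phi_finite (k := k) (k' := k') s (p ^ m) hq) ?_ p m (T : Set E) hT ?_
  · exact (MvPolynomial.map_injective _ (algebraMap k k').injective).comp
      (MvPolynomial.expand_injective hq)
  · intro e he
    refine ⟨a e, d e, hd e, had e, ?_, ?_⟩
    · refine mv_root p m _ fun x hx => hk' _ (Or.inl ?_)
      exact Set.mem_biUnion he ⟨x, hx, rfl⟩
    · refine mv_root p m _ fun x hx => hk' _ (Or.inr ?_)
      exact Set.mem_biUnion he ⟨x, hx, rfl⟩

lemma finite_of_separable {A F E N : Type*} [CommRing A] [IsDomain A] [IsNoetherianRing A]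
    [Field F] [Field E] [Field N] [Algebra A F] [IsFractionRing A F] [Algebra F E]
    [FiniteDimensional F E] [Algebra A E] [IsScalarTower A F E] [Algebra E N]
    [FiniteDimensional E N] [Algebra.IsSeparable E N] [Algebra A N] [IsScalarTower A E N]
    (h : Module.Finite A (integralClosure A E)) : Module.Finite A (integralClosure A N) := by
  let C := integralClosure A E
  have : IsIntegrallyClosed C := integralClosure.isIntegrallyClosedOfFiniteExtension F
  have : IsFractionRing C E := integralClosure.isFractionRing_of_finite_extension F E
  have : IsNoetherianRing C := IsNoetherianRing.of_finite A C
  have hf : Module.Finite C (integralClosure C N) := IsIntegralClosure.finite C E N _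
  have : IsScalarTower A C N := IsScalarTower.of_algebraMap_eq fun x => by
    rw [IsScalarTower.algebraMap_apply A E N]; rfl
  have : Module.Finite A (integralClosure C N) := Module.Finite.trans C _
  let ψ : integralClosure A N →ₗ[A] integralClosure C N :=
    { toFun := fun x => ⟨x.1, IsIntegral.tower_top x.2⟩
      map_add' := fun _ _ => rfl
      map_smul' := fun _ _ => rfl }
  exact Module.Finite.of_injective ψ fun x y hxy => by
    have : x.1 = y.1 := congrArg (fun z : integralClosure C N => (z : N)) hxy
    exact Subtype.ext this

lemma fixed_pi {F N : Type*} [Field F] [Field N] [Algebra F N] [FiniteDimensional F N]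
    [Normal F N] :
    IsPurelyInseparable F (IntermediateField.fixedField (⊤ : Subgroup Gal(N/F))) := by
  classical
  rw [isPurelyInseparable_iff_natSepDegree_eq_one]
  intro x
  rw [IntermediateField.minpoly_eq]
  rw [Polynomial.natSepDegree_eq_of_splits (E := N) _ (Normal.splits inferInstance x.1)]
  rw [Finset.card_eq_one]
  refine ⟨x.1, ?_⟩
  have hint : IsIntegral F x.1 := Algebra.IsIntegral.isIntegral _
  ext y
  rw [Multiset.mem_toFinset, Finset.mem_singleton, Polynomial.mem_aroots]
  constructor
  · rintro ⟨-, hy⟩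
    obtain ⟨σ, hσ⟩ := minpoly.exists_algEquiv_of_root' hint.isAlgebraic hy
    rw [← hσ]
    exact (IntermediateField.mem_fixedField_iff _ _).mp x.2 σ trivial
  · rintro rfl
    exact ⟨minpoly.ne_zero hint, minpoly.aeval _ _⟩

lemma embed_finite {A F K N : Type*} [CommRing A] [IsNoetherianRing A] [Field F] [Field K]
    [Field N] [Algebra A F] [Algebra F K] [Algebra F N] [Algebra A K] [Algebra A N]
    [IsScalarTower A F K] [IsScalarTower A F N] (j : K →ₐ[F] N)
    (h : Module.Finite A (integralClosure A N)) : Module.Finite A (integralClosure A K) := by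
  let j' : K →ₐ[A] N := j.restrictScalars A
  let ψ : integralClosure A K →ₗ[A] integralClosure A N :=
    { toFun := fun x => ⟨j' x.1, IsIntegral.map j' x.2⟩
      map_add' := fun x y => Subtype.ext (map_add j' x.1 y.1)
      map_smul' := fun a x => Subtype.ext (map_smul j' a x.1) }
  exact Module.Finite.of_injective ψ fun x y hxy => by
    have : j x.1 = j y.1 := congrArg Subtype.val hxy
    exact Subtype.ext (j.injective this)

lemma finite_field_ext {k : Type*} [Field k] (s : ℕ) {F K : Type*} [Field F] [Field K]
    [Algebra (MvPolynomial (Fin s) k) F] [IsFractionRing (MvPolynomial (Fin s) k) F]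
    [Algebra F K] [FiniteDimensional F K]
    [Algebra (MvPolynomial (Fin s) k) K] [IsScalarTower (MvPolynomial (Fin s) k) F K] :
    Module.Finite (MvPolynomial (Fin s) k) (integralClosure (MvPolynomial (Fin s) k) K) := by
  let A := MvPolynomial (Fin s) k
  let N := IntermediateField.normalClosure F K (AlgebraicClosure K)
  have : Normal F (AlgebraicClosure K) := ⟨fun x => IsAlgClosed.splits _⟩
  let E := IntermediateField.fixedField (⊤ : Subgroup Gal(N/F))
  have : IsPurelyInseparable F E := fixed_pi
  have : Algebra.IsSeparable E N :=
    (IsGalois.of_fixed_field N (⊤ : Subgroup Gal(N/F))).to_isSeparable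
  let : Algebra A N := ((algebraMap F N).comp (algebraMap A F)).toAlgebra
  have : IsScalarTower A F N := IsScalarTower.of_algebraMap_eq fun x => rfl
  let : Algebra A E := ((algebraMap F E).comp (algebraMap A F)).toAlgebra
  have : IsScalarTower A F E := IsScalarTower.of_algebraMap_eq fun x => rfl
  have : IsScalarTower A E N := IsScalarTower.of_algebraMap_eq fun x => rfl
  have h1 : Module.Finite A (integralClosure A E) := finite_purely_insep (F := F) s
  have h2 : Module.Finite A (integralClosure A N) := finite_of_separable (F := F) h1
  exact embed_finite (IsScalarTower.toAlgHom F K N) h2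

lemma finite_domain {k A : Type*} [Field k] [CommRing A] [IsDomain A] [Algebra k A]
    [Algebra.FiniteType k A] : Module.Finite A (integralClosure A (FractionRing A)) := by
  obtain ⟨s, g, hg, hfin⟩ := exists_finite_inj_algHom_of_fg k A
  let A0 := MvPolynomial (Fin s) k
  let : Algebra A0 A := g.toRingHom.toAlgebra
  have : Module.Finite A0 A := hfin
  have hg' : Function.Injective (algebraMap A0 A) := hg
  have : FaithfulSMul A0 A := (faithfulSMul_iff_algebraMap_injective _ _).mpr hg'
  let K := FractionRing A
  have hinj : Function.Injective (algebraMap A0 K) := by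
    rw [IsScalarTower.algebraMap_eq A0 A K]
    exact (IsFractionRing.injective A K).comp hg'
  let F := FractionRing A0
  let : Algebra F K := (IsFractionRing.lift hinj).toAlgebra
  have : IsScalarTower A0 F K := IsScalarTower.of_algebraMap_eq fun x =>
    (IsFractionRing.lift_algebraMap hinj x).symm
  have : FiniteDimensional F K := .of_isLocalization A0 A (nonZeroDivisors A0)
  have h : Module.Finite A0 (integralClosure A0 K) := finite_field_ext (F := F) s
  let ψ : integralClosure A K →ₗ[A0] integralClosure A0 K :=
    { toFun := fun x => ⟨x.1, isIntegral_trans (A := A) x.1 x.2⟩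
      map_add' := fun _ _ => rfl
      map_smul' := fun _ _ => rfl }
  have : Module.Finite A0 (integralClosure A K) :=
    Module.Finite.of_injective ψ fun x y hxy => by
      have : x.1 = y.1 := congrArg (fun z : integralClosure A0 K => (z : K)) hxy
      exact Subtype.ext this
  exact Module.Finite.of_restrictScalars_finite A0 A _

lemma finite_reduced {k A : Type*} [Field k] [CommRing A] [IsReduced A] [Algebra k A]
    [Algebra.FiniteType k A] : Module.Finite A (integralClosure A (FractionRing A)) := by
  have : IsNoetherianRing A := Algebra.FiniteType.isNoetherianRing k A
  let Q := FractionRing A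
  let ι := minimalPrimes A
  have : Finite ι := (minimalPrimes.finite_of_isNoetherianRing A).to_subtype
  have hp (P : ι) : P.1.IsPrime := P.2.1.1
  let K (P : ι) := FractionRing (A ⧸ P.1)
  have hfin (P : ι) : Module.Finite A (integralClosure (A ⧸ P.1) (K P)) := by
    have : Algebra.FiniteType k (A ⧸ P.1) := inferInstance
    have := finite_domain (k := k) (A := A ⧸ P.1)
    exact Module.Finite.trans (A ⧸ P.1) _
  have hker (P : ι) (a : A) : algebraMap A (K P) a = 0 ↔ a ∈ P.1 := by
    rw [IsScalarTower.algebraMap_apply A (A ⧸ P.1) (K P),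
      map_eq_zero_iff _ (IsFractionRing.injective (A ⧸ P.1) (K P))]
    exact Ideal.Quotient.eq_zero_iff_mem
  have hu (P : ι) (y : nonZeroDivisors A) : IsUnit (algebraMap A (K P) y) := by
    rw [isUnit_iff_ne_zero, Ne, hker]
    intro hy
    exact (Set.disjoint_left.mp (Ideal.disjoint_nonZeroDivisors_of_mem_minimalPrimes P.2)) hy y.2
  let θ (P : ι) : Q →ₐ[A] K P := IsLocalization.liftAlgHom (M := nonZeroDivisors A)
    (f := Algebra.ofId A (K P)) (hu P)
  let ψ : integralClosure A Q →ₗ[A] Π P : ι, integralClosure (A ⧸ P.1) (K P) :=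
    LinearMap.pi fun P =>
    { toFun := fun x => ⟨θ P x.1, (IsIntegral.map (θ P) x.2).tower_top⟩
      map_add' := fun x y => Subtype.ext (map_add (θ P) x.1 y.1)
      map_smul' := fun a x => Subtype.ext (map_smul (θ P) a x.1) }
  refine Module.Finite.of_injective ψ ?_
  rw [injective_iff_map_eq_zero]
  intro x hx
  have hx' (P : ι) : θ P x.1 = 0 := congrArg Subtype.val (congrFun hx P)
  obtain ⟨⟨a, t⟩, hat⟩ := IsLocalization.surj (nonZeroDivisors A) x.1
  have ha : a = 0 := by
    have : a ∈ sInf (minimalPrimes A) := by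
      rw [Ideal.mem_sInf]
      intro P hP
      rw [← hker ⟨P, hP⟩]
      have := congrArg (θ ⟨P, hP⟩) hat
      rw [map_mul, hx', zero_mul] at this
      rw [← (θ ⟨P, hP⟩).commutes a]
      exact this.symm
    rw [minimalPrimes, Ideal.sInf_minimalPrimes] at this
    rw [← Ideal.zero_eq_bot] at this
    exact (nilradical_eq_zero A ▸ this : a ∈ (0 : Ideal A))
  apply Subtype.ext
  rw [ha, map_zero] at hat
  exact (IsLocalization.map_units Q t).mul_left_eq_zero.mp hat

lemma localize_closure {A LI : Type*} [CommRing A] [CommRing LI] [Algebra A LI] (M : Submonoid A)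
    [IsLocalization M LI] (hM : M ≤ nonZeroDivisors A)
    (hfin : Module.Finite A (integralClosure A (FractionRing A)))
    (S' : Submonoid (integralClosure A (FractionRing A)))
    (hS' : S' = M.map (algebraMap A (integralClosure A (FractionRing A))).toMonoidHom) :
    Module.Finite LI (integralClosure LI (FractionRing LI)) ∧
    ∃ eq : integralClosure LI (FractionRing LI) ≃+* Localization S',
      ∀ a : A, eq (algebraMap LI (integralClosure LI (FractionRing LI)) (algebraMap A LI a)) =
        algebraMap _ (Localization S')
          (algebraMap A (integralClosure A (FractionRing A)) a) := by
  let Q := FractionRing A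
  have hunits (y : M) : IsUnit (algebraMap A Q y) := IsLocalization.map_units Q ⟨y.1, hM y.2⟩
  let : Algebra LI Q := (IsLocalization.lift (M := M) (S := LI) hunits).toAlgebra
  have : IsScalarTower A LI Q := IsScalarTower.of_algebraMap_eq fun x =>
    (IsLocalization.lift_eq hunits x).symm
  have : IsFractionRing LI Q := IsFractionRing.isFractionRing_of_isLocalization M LI Q hM
  have : IsLocalization (Algebra.algebraMapSubmonoid Q M) Q := by
    refine IsLocalization.self ?_
    rintro _ ⟨y, hy, rfl⟩
    exact hunits ⟨y, hy⟩
  let B := integralClosure A Q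
  let D := integralClosure LI Q
  let j : B →+* D :=
    { toFun := fun x => ⟨x.1, IsIntegral.tower_top x.2⟩
      map_add' := fun _ _ => rfl
      map_mul' := fun _ _ => rfl
      map_one' := rfl
      map_zero' := rfl }
  let : Algebra B D := j.toAlgebra
  have : IsScalarTower B D Q := IsScalarTower.of_algebraMap_eq fun x => rfl
  have : IsScalarTower A B D := IsScalarTower.of_algebraMap_eq fun x => by
    apply Subtype.ext
    rfl
  have hloc : IsLocalization (Algebra.algebraMapSubmonoid B M) D :=
    IsLocalization.integralClosure (S := Q) (Rf := LI) (Sf := Q) M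
  have hfinD : Module.Finite LI D := Module.Finite.of_isLocalization A B M
  let e : D ≃ₐ[LI] integralClosure LI (FractionRing LI) :=
    ((FractionRing.algEquiv LI Q).symm).mapIntegralClosure
  subst hS'
  refine ⟨Module.Finite.equiv e.toLinearEquiv, ?_⟩
  let e2 : D ≃ₐ[B] Localization (Algebra.algebraMapSubmonoid B M) :=
    IsLocalization.algEquiv (Algebra.algebraMapSubmonoid B M) D _
  refine ⟨e.symm.toRingEquiv.trans e2.toRingEquiv, fun a => ?_⟩
  have h1 : e.symm (algebraMap LI (integralClosure LI (FractionRing LI)) (algebraMap A LI a)) =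
      algebraMap B D (algebraMap A B a) := by
    rw [e.symm.commutes, ← IsScalarTower.algebraMap_apply A B D,
      ← IsScalarTower.algebraMap_apply A LI D]
  change e2 (e.symm _) = _
  rw [h1]
  exact e2.commutes _

end NormLoc

set_option synthInstance.maxHeartbeats 1000000
set_option maxHeartbeats 16000000

/-- Let `>` be a monomial ordering (encoded by a linear order `le` on
exponent vectors compatible with addition), `S = S_> = {u ≠ 0 : LM(u) = 1}`, and let `L`
be (a ring isomorphic to) the localization `R_> = S⁻¹R` of `R = k[x₁,…,xₙ]`, with
localization map `f : R → L`. For a radical ideal `I ⊆ L` with `I' = f⁻¹(I)`, the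
integral closure of `L/I` in its total ring of fractions is a finite module over `L/I`
and is isomorphic, compatibly with the maps from `R`, to the localization at the image of
`S` of the integral closure of `R/I'` in its total ring of fractions. -/
theorem normalization_of_localization
    (k : Type*) [Field k] (n : ℕ)
    (le : (Fin n →₀ ℕ) → (Fin n →₀ ℕ) → Prop)
    (htot : ∀ a b, le a b ∨ le b a)
    (htrans : ∀ a b c, le a b → le b c → le a c)
    (hanti : ∀ a b, le a b → le b a → a = b)
    (hcomp : ∀ a b c, le a b → le (a + c) (b + c))
    (S : Submonoid (MvPolynomial (Fin n) k))
    (hS : (S : Set (MvPolynomial (Fin n) k)) =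
      {u | (0 : Fin n →₀ ℕ) ∈ u.support ∧ ∀ m ∈ u.support, le m 0})
    (L : Type*) [CommRing L] (e : L ≃+* Localization S)
    (I : Ideal L) (hrad : I.IsRadical) :
    let R := MvPolynomial (Fin n) k
    let f : R →+* L := (e.symm : Localization S →+* L).comp (algebraMap R (Localization S))
    let I' : Ideal R := I.comap f
    let B := integralClosure (R ⧸ I') (FractionRing (R ⧸ I'))
    let S' : Submonoid B :=
      S.map ((algebraMap (R ⧸ I') B).comp (Ideal.Quotient.mk I')).toMonoidHom
    Module.Finite (L ⧸ I) (integralClosure (L ⧸ I) (FractionRing (L ⧸ I))) ∧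
    ∃ eq : (integralClosure (L ⧸ I) (FractionRing (L ⧸ I))) ≃+* Localization S',
      ∀ r : R,
        eq (algebraMap (L ⧸ I) (integralClosure (L ⧸ I) (FractionRing (L ⧸ I)))
            (Ideal.Quotient.mk I (f r)))
          = algebraMap B (Localization S')
              (algebraMap (R ⧸ I') B (Ideal.Quotient.mk I' r)) := by
  intro R f I' B S'
  let : Algebra R L := f.toAlgebra
  have hL : IsLocalization S L :=
    IsLocalization.isLocalization_of_algEquiv S
      (AlgEquiv.ofRingEquiv (R := R) (f := e.symm) fun x => rfl)
  let : Algebra (R ⧸ I') (L ⧸ I) := (Ideal.quotientMap I f le_rfl).toAlgebra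
  have hmk (r : R) : algebraMap (R ⧸ I') (L ⧸ I) (Ideal.Quotient.mk I' r) =
      Ideal.Quotient.mk I (f r) := rfl
  let M : Submonoid (R ⧸ I') := S.map (Ideal.Quotient.mk I')
  have hloc : IsLocalization M (L ⧸ I) := by
    refine IsLocalization.of_surjective S L (Ideal.Quotient.mk I') Ideal.Quotient.mk_surjective
      (Ideal.Quotient.mk I) Ideal.Quotient.mk_surjective ?_ ?_
    · exact RingHom.ext fun r => rfl
    · rw [Ideal.mk_ker, Ideal.mk_ker]
      exact (IsLocalization.map_under S L I).ge
  have hM : M ≤ nonZeroDivisors (R ⧸ I') := by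
    rintro _ ⟨t, ht, rfl⟩
    rw [mem_nonZeroDivisors_iff_right]
    intro x hx
    obtain ⟨r, rfl⟩ := Ideal.Quotient.mk_surjective x
    have hx' : Ideal.Quotient.mk I' (r * t) = 0 := by rw [map_mul]; exact hx
    rw [Ideal.Quotient.eq_zero_iff_mem] at hx' ⊢
    have h1 : f r * f t ∈ I := by rw [← map_mul]; exact hx'
    have hu : IsUnit (f t) := IsLocalization.map_units L (⟨t, ht⟩ : S)
    exact (Ideal.mul_unit_mem_iff_mem I hu).mp h1
  have hred : IsReduced (R ⧸ I') :=
    (Ideal.isRadical_iff_quotient_reduced I').mp (hrad.comap f)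
  have hfin := NormLoc.finite_reduced (k := k) (A := R ⧸ I')
  have hS' : S' = M.map (algebraMap (R ⧸ I') B).toMonoidHom := by
    ext x
    constructor
    · rintro ⟨t, ht, rfl⟩
      exact ⟨_, ⟨t, ht, rfl⟩, rfl⟩
    · rintro ⟨_, ⟨t, ht, rfl⟩, rfl⟩
      exact ⟨t, ht, rfl⟩
  obtain ⟨h1, eq, h2⟩ := NormLoc.localize_closure (LI := L ⧸ I) M hM hfin S' hS'
  exact ⟨h1, eq, fun r => h2 (Ideal.Quotient.mk I' r)⟩
end
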